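/- Σ_{k=0}^∞ 1/(k+1)³ = (1/64) · Σ_{n=0}^∞ [(1)_n⁵ / (1/2)_n⁵] · (205n² + 250n + 77)/(2n+1)⁵ · (−1/1024)^n; that is, ζ(3) equals the Amdeberhan–Zeilberger fast series. -/

import Mathlib

/-- The Pochhammer symbol (rising factorial): `poch a n = a (a+1) ⋯ (a+n-1)`. -/
noncomputable def poch (a : ℝ) (n : ℕ) : ℝ := (ascPochhammer ℝ n).eval a

open Filter Topology Finset Nat

/-- The absolute value of the first member of the WZ pair. -/
noncomputable def wzAbs (n k : ℕ) : ℝ :=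
  (n ! : ℝ) ^ 6 / ((2 * n)! : ℝ) * (3 * n + 2 + 2 * k) * (((n + k)! : ℝ) / (2 * n + k + 1)!) ^ 4

/-- The polynomial part of the WZ certificate. -/
noncomputable def wzPoly (n k : ℝ) : ℝ :=
  (n + 1) * ((77 + 558 * n + 1667 * n ^ 2 + 2628 * n ^ 3 + 2307 * n ^ 4 + 1070 * n ^ 5
      + 205 * n ^ 6)
    + (254 + 1526 * n + 3628 * n ^ 2 + 4268 * n ^ 3 + 2486 * n ^ 4 + 574 * n ^ 5) * k
    + (344 + 1648 * n + 2928 * n ^ 2 + 2288 * n ^ 3 + 664 * n ^ 4) * k ^ 2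
    + (248 + 888 * n + 1048 * n ^ 2 + 408 * n ^ 3) * k ^ 3
    + (101 + 240 * n + 141 * n ^ 2) * k ^ 4 + (22 + 26 * n) * k ^ 5 + 2 * k ^ 6)

/-- The absolute value of the second member of the WZ pair. -/
noncomputable def wzMateAbs (n k : ℕ) : ℝ :=
  (n ! : ℝ) ^ 6 / ((2 * n + 2)! : ℝ) * (((n + k)! : ℝ) / (2 * n + k + 2)!) ^ 4 * wzPoly n k

/-- The rational-function identity behind the WZ equation. -/
lemma wzPoly_identity (n k : ℝ) :
    (2 * n + 1) * (2 * n + 2) * (3 * n + 2 + 2 * k) * ((2 * n + k + 2) * (2 * n + k + 3)) ^ 4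
      + (n + 1) ^ 6 * (3 * n + 5 + 2 * k) * (n + k + 1) ^ 4
      = (2 * n + k + 3) ^ 4 * wzPoly n k - (n + k + 1) ^ 4 * wzPoly n (k + 1) := by
  unfold wzPoly
  ring

lemma wzAbs_nonneg (n k : ℕ) : 0 ≤ wzAbs n k := by
  unfold wzAbs
  positivity

lemma wzAbs_eq (n k : ℕ) :
    wzAbs n k = (n ! : ℝ) ^ 6 / ((2 * n + 2)! : ℝ) * (((n + k)! : ℝ) / (2 * n + k + 3)!) ^ 4 *
      ((2 * n + 1) * (2 * n + 2) * (3 * n + 2 + 2 * k) *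
        ((2 * n + k + 2) * (2 * n + k + 3)) ^ 4) := by
  rw [wzAbs, factorial_succ (2 * n + 1), factorial_succ (2 * n),
    factorial_succ (2 * n + k + 2), factorial_succ (2 * n + k + 1)]
  have h₁ : ((2 * n)! : ℝ) ≠ 0 := by positivity
  have h₂ : ((2 * n + k + 1)! : ℝ) ≠ 0 := by positivity
  push_cast
  field_simp
  ring

lemma wzAbs_succ_eq (n k : ℕ) :
    wzAbs (n + 1) k = (n ! : ℝ) ^ 6 / ((2 * n + 2)! : ℝ) *
      (((n + k)! : ℝ) / (2 * n + k + 3)!) ^ 4 *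
      ((n + 1) ^ 6 * (3 * n + 5 + 2 * k) * (n + k + 1) ^ 4) := by
  rw [wzAbs, show n + 1 + k = n + k + 1 by ring, show 2 * (n + 1) = 2 * n + 2 by ring,
    show 2 * n + 2 + k + 1 = 2 * n + k + 3 by ring, factorial_succ n, factorial_succ (n + k)]
  push_cast
  field_simp
  ring

lemma wzMateAbs_eq (n k : ℕ) :
    wzMateAbs n k = (n ! : ℝ) ^ 6 / ((2 * n + 2)! : ℝ) *
      (((n + k)! : ℝ) / (2 * n + k + 3)!) ^ 4 * ((2 * n + k + 3) ^ 4 * wzPoly n k) := by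
  rw [wzMateAbs, factorial_succ (2 * n + k + 2)]
  have h₂ : ((2 * n + k + 2)! : ℝ) ≠ 0 := by positivity
  push_cast
  field_simp
  ring

lemma wzMateAbs_succ_eq (n k : ℕ) :
    wzMateAbs n (k + 1) = (n ! : ℝ) ^ 6 / ((2 * n + 2)! : ℝ) *
      (((n + k)! : ℝ) / (2 * n + k + 3)!) ^ 4 * ((n + k + 1) ^ 4 * wzPoly n (k + 1)) := by
  rw [wzMateAbs, show n + (k + 1) = n + k + 1 by ring,
    show 2 * n + (k + 1) + 2 = 2 * n + k + 3 by ring, factorial_succ (n + k)]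
  push_cast
  field_simp

/-- The WZ equation, with the alternating sign removed. -/
lemma wzAbs_add_succ (n k : ℕ) :
    wzAbs n k + wzAbs (n + 1) k = wzMateAbs n k - wzMateAbs n (k + 1) := by
  rw [wzAbs_eq, wzAbs_succ_eq, wzMateAbs_eq, wzMateAbs_succ_eq, ← mul_add, ← mul_sub,
    wzPoly_identity]

lemma wzAbs_succ_le (n k : ℕ) : wzAbs (n + 1) k ≤ wzAbs n k * (1 / 2) := by
  rw [wzAbs_succ_eq, wzAbs_eq, mul_assoc _ _ (1 / 2 : ℝ)]
  refine mul_le_mul_of_nonneg_left ?_ (by positivity)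
  have hn : (0 : ℝ) ≤ n := n.cast_nonneg
  have hk : (0 : ℝ) ≤ k := k.cast_nonneg
  have h₁ : ((n : ℝ) + 1) ^ 2 ≤ (2 * n + 1) * (2 * n + 2) := by nlinarith
  have h₂ : (3 * (n : ℝ) + 5 + 2 * k) ≤ 3 * (3 * n + 2 + 2 * k) := by linarith
  have h₃ : ((n : ℝ) + 1) * (n + k + 1) ≤ (2 * n + k + 2) * (2 * n + k + 3) / 2 := by
    nlinarith [mul_nonneg hn hk]
  calc ((n + 1) ^ 6 * (3 * n + 5 + 2 * k) * (n + k + 1) ^ 4 : ℝ)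
      = (n + 1) ^ 2 * (3 * n + 5 + 2 * k) * ((n + 1) * (n + k + 1)) ^ 4 := by ring
    _ ≤ ((2 * n + 1) * (2 * n + 2)) * (3 * (3 * n + 2 + 2 * k)) *
        ((2 * n + k + 2) * (2 * n + k + 3) / 2) ^ 4 := by gcongr
    _ = (2 * n + 1) * (2 * n + 2) * (3 * n + 2 + 2 * k) *
        ((2 * n + k + 2) * (2 * n + k + 3)) ^ 4 * (3 / 16) := by ring
    _ ≤ (2 * n + 1) * (2 * n + 2) * (3 * n + 2 + 2 * k) *
        ((2 * n + k + 2) * (2 * n + k + 3)) ^ 4 * (1 / 2) :=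
        mul_le_mul_of_nonneg_left (by norm_num) (by positivity)

lemma wzAbs_zero (k : ℕ) : wzAbs 0 k = 2 * (1 / ((k : ℝ) + 1) ^ 3) := by
  have h : (k ! : ℝ) ≠ 0 := by positivity
  simp only [wzAbs, mul_zero, zero_add, factorial_succ k, factorial_zero]
  push_cast
  field_simp
  ring

lemma summable_one_div_succ_cube : Summable fun k : ℕ => 1 / ((k : ℝ) + 1) ^ 3 := by
  have h := (summable_nat_add_iff 1).2 (Real.summable_one_div_nat_pow.2 (by norm_num : 1 < 3))
  simpa using h

lemma summable_wzAbs (n : ℕ) : Summable (wzAbs n) := by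
  induction n with
  | zero =>
    rw [show wzAbs 0 = _ from funext wzAbs_zero]
    exact summable_one_div_succ_cube.mul_left 2
  | succ n ih =>
    exact Summable.of_nonneg_of_le (wzAbs_nonneg _) (wzAbs_succ_le n) (ih.mul_right _)

lemma tsum_wzAbs_le (n : ℕ) : ∑' k, wzAbs n k ≤ (∑' k, wzAbs 0 k) * (1 / 2) ^ n := by
  induction n with
  | zero => simp
  | succ n ih =>
    calc ∑' k, wzAbs (n + 1) k ≤ ∑' k, wzAbs n k * (1 / 2) :=
          (summable_wzAbs _).tsum_le_tsum (wzAbs_succ_le n) ((summable_wzAbs n).mul_right _)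
      _ = (∑' k, wzAbs n k) * (1 / 2) := tsum_mul_right
      _ ≤ _ := by rw [pow_succ, ← mul_assoc]; gcongr

lemma wzPoly_nonneg (n k : ℕ) : 0 ≤ wzPoly n k := by
  unfold wzPoly
  positivity

lemma wzPoly_le (n k : ℕ) : wzPoly n k ≤ wzPoly n 1 * ((k : ℝ) + 1) ^ 6 := by
  have hk : (1 : ℝ) ≤ k + 1 := by linarith [(k.cast_nonneg : (0 : ℝ) ≤ k)]
  have h (i : ℕ) (hi : i ≤ 6) : (k : ℝ) ^ i ≤ (k + 1) ^ 6 :=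
    (pow_le_pow_left₀ k.cast_nonneg (by linarith) i).trans (pow_le_pow_right₀ hk hi)
  have h₀ := h 0 (by norm_num)
  have h₁ := h 1 (by norm_num)
  rw [pow_zero] at h₀
  rw [pow_one] at h₁
  unfold wzPoly
  rw [mul_assoc]
  simp only [one_pow, mul_one, add_mul _ _ (((k : ℝ) + 1) ^ 6)]
  refine mul_le_mul_of_nonneg_left ?_ (by positivity)
  simp only [← add_mul _ _ (((k : ℝ) + 1) ^ 6)]
  generalize hX : ((k : ℝ) + 1) ^ 6 = X at *
  have e : ∀ a b c d e f g : ℝ, (a + b + c + d + e + f + g) * X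
      = a * X + b * X + c * X + d * X + e * X + f * X + g * X := by intros; ring
  rw [e]
  gcongr
  · exact le_mul_of_one_le_right (by positivity) h₀
  · exact h 2 (by norm_num)
  · exact h 3 (by norm_num)
  · exact h 4 (by norm_num)
  · exact h 5 (by norm_num)
  · exact h 6 (by norm_num)

lemma factorial_div_le (n k : ℕ) :
    ((n + k)! : ℝ) / (2 * n + k + 2)! ≤ 1 / ((k : ℝ) + 1) ^ 2 := by
  rw [div_le_div_iff₀ (by positivity) (by positivity), one_mul]
  have h : (n + k)! * (k + 1) ^ 2 ≤ (2 * n + k + 2)! :=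
    calc (n + k)! * (k + 1) ^ 2 ≤ (n + k)! * ((n + k + 2) * (n + k + 1)) := by
          rw [pow_two]; gcongr <;> omega
      _ = (n + k + 2)! := by rw [factorial_succ (n + k + 1), factorial_succ (n + k)]; ring
      _ ≤ _ := factorial_le (by omega)
  exact_mod_cast h

lemma tendsto_wzMateAbs (n : ℕ) : Tendsto (wzMateAbs n) atTop (𝓝 0) := by
  set c : ℝ := (n ! : ℝ) ^ 6 / ((2 * n + 2)! : ℝ) * wzPoly n 1 with hc
  have hc' : 0 ≤ c := by
    have := wzPoly_nonneg n 1
    rw [cast_one] at this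
    positivity
  have hlim : Tendsto (fun k : ℕ => c * (1 / ((k : ℝ) + 1))) atTop (𝓝 0) := by
    simpa using tendsto_one_div_add_atTop_nhds_zero_nat.const_mul c
  refine squeeze_zero (fun k => ?_) (fun k => ?_) hlim
  · have := wzPoly_nonneg n k
    unfold wzMateAbs
    positivity
  · have hk : (1 : ℝ) ≤ k + 1 := by linarith [(k.cast_nonneg : (0 : ℝ) ≤ k)]
    have h1 : 0 ≤ wzPoly n 1 := by simpa using wzPoly_nonneg n 1
    calc wzMateAbs n k ≤ (n ! : ℝ) ^ 6 / ((2 * n + 2)! : ℝ) * (1 / ((k : ℝ) + 1) ^ 2) ^ 4 *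
          (wzPoly n 1 * ((k : ℝ) + 1) ^ 6) := by
          have hf := factorial_div_le n k
          have hP := wzPoly_le n k
          unfold wzMateAbs
          refine mul_le_mul (mul_le_mul_of_nonneg_left ?_ (by positivity)) hP
            (wzPoly_nonneg n k) (by positivity)
          exact pow_le_pow_left₀ (by positivity) hf 4
      _ = c * (1 / ((k : ℝ) + 1) ^ 2) := by
          rw [hc]
          field_simp
      _ ≤ c * (1 / ((k : ℝ) + 1)) := by
          gcongr
          exact le_self_pow₀ hk (by norm_num)

lemma tsum_wzAbs_add_succ (n : ℕ) :
    ∑' k, wzAbs n k + ∑' k, wzAbs (n + 1) k = wzMateAbs n 0 := by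
  have h := ((summable_wzAbs n).hasSum.add (summable_wzAbs (n + 1)).hasSum).tendsto_sum_nat
  simp only [wzAbs_add_succ, sum_range_sub'] at h
  have h' := (tendsto_wzMateAbs n).const_sub (wzMateAbs n 0)
  rw [sub_zero] at h'
  exact tendsto_nhds_unique h h'

lemma hasSum_wzMateAbs :
    HasSum (fun n : ℕ => (-1 : ℝ) ^ n * wzMateAbs n 0) (∑' k, wzAbs 0 k) := by
  have hnn (n : ℕ) : 0 ≤ ∑' k, wzAbs n k := tsum_nonneg (wzAbs_nonneg n)
  have hgeo : Summable fun n : ℕ => (∑' k, wzAbs 0 k) * (1 / 2 : ℝ) ^ n :=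
    summable_geometric_two.mul_left _
  have hS : Summable fun n : ℕ => ∑' k, wzAbs n k :=
    Summable.of_nonneg_of_le hnn tsum_wzAbs_le hgeo
  have hsum : Summable fun n : ℕ => (-1 : ℝ) ^ n * wzMateAbs n 0 := by
    refine Summable.of_norm ?_
    refine (hS.add ((summable_nat_add_iff 1).2 hS)).congr fun n => ?_
    rw [norm_mul, norm_pow, norm_neg, norm_one, one_pow, one_mul, ← tsum_wzAbs_add_succ,
      Real.norm_of_nonneg (add_nonneg (hnn _) (hnn _))]
  refine (hsum.hasSum_iff_tendsto_nat).2 ?_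
  have htel (n : ℕ) : (-1 : ℝ) ^ n * wzMateAbs n 0 =
      (-1) ^ n * ∑' k, wzAbs n k - (-1) ^ (n + 1) * ∑' k, wzAbs (n + 1) k := by
    rw [← tsum_wzAbs_add_succ]
    ring
  simp only [htel, sum_range_sub' fun n : ℕ => (-1 : ℝ) ^ n * ∑' k, wzAbs n k, pow_zero, one_mul]
  have h0 : Tendsto (fun n : ℕ => (-1 : ℝ) ^ n * ∑' k, wzAbs n k) atTop (𝓝 0) := by
    refine squeeze_zero_norm (fun n => ?_) hS.tendsto_atTop_zero
    rw [norm_mul, norm_pow, norm_neg, norm_one, one_pow, one_mul, Real.norm_of_nonneg (hnn n)]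
  have h := h0.const_sub ((-1 : ℝ) ^ 0 * ∑' k, wzAbs 0 k)
  rwa [sub_zero, pow_zero, one_mul] at h

lemma poch_succ (a : ℝ) (n : ℕ) : poch a (n + 1) = poch a n * (a + n) := by
  simp [poch, ascPochhammer_succ_eval]

lemma poch_one (n : ℕ) : poch 1 n = n ! := by
  simp [poch, ascPochhammer_eval_one]

lemma poch_half (n : ℕ) : poch (1 / 2) n = (2 * n)! / (4 ^ n * n !) := by
  induction n with
  | zero => simp [poch]
  | succ n ih =>
    rw [poch_succ, ih, show 2 * (n + 1) = 2 * n + 1 + 1 by ring, factorial_succ (2 * n + 1),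
      factorial_succ (2 * n), factorial_succ n]
    push_cast
    field_simp
    ring

lemma amdeberhan_zeilberger_term (n : ℕ) :
    (poch 1 n) ^ 5 / (poch (1 / 2) n) ^ 5 *
      ((205 * (n : ℝ) ^ 2 + 250 * (n : ℝ) + 77) / (2 * (n : ℝ) + 1) ^ 5) *
      (-1 / 1024 : ℝ) ^ n = 32 * ((-1) ^ n * wzMateAbs n 0) := by
  have hpoly : wzPoly n 0 = ((n : ℝ) + 1) ^ 5 * (205 * (n : ℝ) ^ 2 + 250 * n + 77) := by
    unfold wzPoly
    ring
  have hpow : (-1 / 1024 : ℝ) ^ n = (-1) ^ n / (4 ^ n) ^ 5 := by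
    rw [div_pow, ← pow_mul, mul_comm n 5, pow_mul]
    norm_num
  rw [poch_one, poch_half, wzMateAbs, cast_zero, hpoly, hpow, add_zero, add_zero,
    factorial_succ (2 * n + 1), factorial_succ (2 * n)]
  have h₁ : ((2 * n)! : ℝ) ≠ 0 := by positivity
  have h₂ : (n ! : ℝ) ≠ 0 := by positivity
  push_cast
  rw [show (2 * (n : ℝ) + 1 + 1) = 2 * (n + 1) by ring]
  field_simp
  ring

theorem zeta3_amdeberhan_zeilberger :
    ∑' k : ℕ, 1 / ((k : ℝ) + 1) ^ 3 =
      (1 / 64 : ℝ) *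
        ∑' n : ℕ, (poch 1 n) ^ 5 / (poch (1 / 2) n) ^ 5 *
          ((205 * (n : ℝ) ^ 2 + 250 * (n : ℝ) + 77) / (2 * (n : ℝ) + 1) ^ 5) *
          (-1 / 1024 : ℝ) ^ n := by
  have h := hasSum_wzMateAbs.tsum_eq
  simp only [wzAbs_zero, tsum_mul_left] at h
  simp only [amdeberhan_zeilberger_term, tsum_mul_left]
  rw [h]
  ring
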